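/- Let G be a finite connected simple graph with two distinguished vertices m1 ≠ m2 (the monitors), m1m2 ∉ E(G), with the interior graph H = G − m1 − m2 connected, and suppose (①) G − e is 2-edge-connected for every interior link e of G, and (②) G + m1m2 is 3-vertex-connected. Then for every interior link vw of G there exist a non-separating cycle F with vw ∈ E(F), a cycle C with vw ∈ E(C), a simple path P1 connecting one monitor with a vertex of F − v − w, and a simple path P2 connecting the other monitor with a vertex of C − v − w, such that: (a) F and C have at most one common vertex other than v and w (i.e., |V(F) ∩ V(C)| ≤ 3); (b) P1 and P2 are vertex-disjoint and neither P1 nor P2 contains v or w; (c) |V(P1) ∩ V(F)| = 1 and |V(P2) ∩ V(C)| = 1. -/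

import Mathlib

open SimpleGraph

/-- The total weight of a walk: the sum of the weights of its edges. -/
def walkWeight {V : Type*} (G : SimpleGraph V) {u v : V} (w : Sym2 V → ℝ) (p : G.Walk u v) : ℝ :=
  (p.edges.map w).sum

/-- An edge is identifiable if any two weight functions agreeing on the total weight of
every simple path between the monitors m1 and m2 agree on that edge. -/
def Identifiable {V : Type*} (G : SimpleGraph V) (m1 m2 : V) (e : Sym2 V) : Prop :=
  ∀ w w' : Sym2 V → ℝ,
    (∀ p : G.Walk m1 m2, p.IsPath → walkWeight G w p = walkWeight G w' p) →
    w e = w' e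

/-- k-vertex-connectivity: more than k vertices, and still connected after deleting
any set of fewer than k vertices. -/
def KVertexConnected {V : Type*} [Fintype V] [DecidableEq V] (G : SimpleGraph V) (k : ℕ) : Prop :=
  k < Fintype.card V ∧
  ∀ S : Finset V, S.card < k → (G.induce (↑(Sᶜ) : Set V)).Connected

/-- k-edge-connectivity: at least two vertices, and still connected after deleting
any set of fewer than k edges. -/
def KEdgeConnected {V : Type*} [Fintype V] (G : SimpleGraph V) (k : ℕ) : Prop :=
  2 ≤ Fintype.card V ∧
  ∀ F : Finset (Sym2 V), F.card < k → (G.deleteEdges ↑F).Connected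

/-- The extended graph: add two virtual monitors (`Sum.inr false` and `Sum.inr true`),
each adjacent to every monitor in M, with no edge joining the two virtual monitors. -/
def extendedGraph {V : Type*} (G : SimpleGraph V) (M : Set V) : SimpleGraph (V ⊕ Bool) :=
  SimpleGraph.fromRel (fun a b =>
    match a, b with
    | Sum.inl u, Sum.inl v => G.Adj u v
    | Sum.inl u, Sum.inr _ => u ∈ M
    | Sum.inr _, Sum.inl v => v ∈ M
    | Sum.inr _, Sum.inr _ => False)

/-- A cycle (given as a closed walk) is non-separating if, after deleting all its
vertices, every connected component of the remaining graph contains a monitor. -/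
def NonSeparatingCycle {V : Type*} (G : SimpleGraph V) (m1 m2 : V) {a : V}
    (c : G.Walk a a) : Prop :=
  ∀ x : {v : V // v ∉ c.support}, ∃ y : {v : V // v ∉ c.support},
    ((y : V) = m1 ∨ (y : V) = m2) ∧
    (G.induce {v | v ∉ c.support}).Reachable x y


namespace CPIL

variable {V : Type*}

/-- `a` and `b` are joined by a walk of `G` inside `S`. -/
def J (G : SimpleGraph V) (S : Set V) (a b : V) : Prop :=
  ∃ p : G.Walk a b, ∀ x ∈ p.support, x ∈ S

/-- `S` induces a connected (or empty) subgraph. -/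
def Cn (G : SimpleGraph V) (S : Set V) : Prop := ∀ a ∈ S, ∀ b ∈ S, J G S a b

theorem J.refl {G : SimpleGraph V} {S : Set V} {a : V} (h : a ∈ S) : J G S a a :=
  ⟨Walk.nil, by simpa using h⟩

theorem J.symm {G : SimpleGraph V} {S : Set V} {a b : V} (h : J G S a b) : J G S b a := by
  obtain ⟨p, hp⟩ := h
  exact ⟨p.reverse, by simpa using hp⟩

theorem J.trans {G : SimpleGraph V} {S : Set V} {a b c : V} (h : J G S a b) (h' : J G S b c) :
    J G S a c := by
  obtain ⟨p, hp⟩ := h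
  obtain ⟨q, hq⟩ := h'
  refine ⟨p.append q, fun x hx => ?_⟩
  rcases (Walk.mem_support_append_iff _ _).1 hx with h | h
  · exact hp x h
  · exact hq x h

theorem J.left {G : SimpleGraph V} {S : Set V} {a b : V} (h : J G S a b) : a ∈ S := by
  obtain ⟨p, hp⟩ := h
  exact hp _ p.start_mem_support

theorem J.right {G : SimpleGraph V} {S : Set V} {a b : V} (h : J G S a b) : b ∈ S := h.symm.left

theorem J.adj {G : SimpleGraph V} {S : Set V} {a b : V} (ha : a ∈ S) (hb : b ∈ S)
    (h : G.Adj a b) : J G S a b :=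
  ⟨Walk.cons h Walk.nil, by
    intro x hx
    simp at hx
    rcases hx with rfl | rfl <;> assumption⟩

theorem J.step {G : SimpleGraph V} {S : Set V} {a b c : V} (h : J G S a b) (hc : c ∈ S)
    (hbc : G.Adj b c) : J G S a c := h.trans (J.adj h.right hc hbc)

theorem J.closed {G : SimpleGraph V} {S : Set V} {a b : V} (h : J G S a b) (U : Set V)
    (ha : a ∈ U) (hU : ∀ x ∈ U, ∀ y ∈ S, G.Adj x y → y ∈ U) : b ∈ U := by
  obtain ⟨p, hp⟩ := h
  induction p with
  | nil => exact ha
  | cons hadj p ih =>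
    apply ih
    · exact hU _ ha _ (hp _ (by simp)) hadj
    · intro x hx
      exact hp x (by simp [hx])

theorem J.mono' {G G' : SimpleGraph V} {S T : Set V} {a b : V} (h : J G S a b) (hST : S ⊆ T)
    (hadj : ∀ x ∈ S, ∀ y ∈ S, G.Adj x y → G'.Adj x y) : J G' T a b := by
  have := h.closed {x | x ∈ S ∧ J G' T a x} ⟨h.left, J.refl (hST h.left)⟩ (by
    rintro x ⟨hx, hx'⟩ y hy hxy
    exact ⟨hy, hx'.step (hST hy) (hadj x hx y hy hxy)⟩)
  exact this.2

theorem J.mono {G : SimpleGraph V} {S T : Set V} {a b : V} (h : J G S a b) (hST : S ⊆ T) :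
    J G T a b := h.mono' hST (fun _ _ _ _ h => h)

/-- The component of `a` in `G[S]`. -/
def comp (G : SimpleGraph V) (S : Set V) (a : V) : Set V := {x | J G S a x}

theorem comp_sub {G : SimpleGraph V} {S : Set V} {a : V} : comp G S a ⊆ S :=
  fun _ h => J.right h

theorem comp_J {G : SimpleGraph V} {S : Set V} {a x : V} (h : x ∈ comp G S a) :
    J G (comp G S a) a x := by
  have h' : J G S a x := h
  have ha : a ∈ comp G S a := J.refl h'.left
  have := h'.closed {x | J G (comp G S a) a x} (J.refl ha) (by
    intro x hx y hy hxy
    exact J.step hx (J.step (comp_sub.trans (le_refl _) |> fun h => J.mono hx h) hy hxy) hxy)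
  exact this

theorem Cn_of {G : SimpleGraph V} {S : Set V} {a : V} (h : ∀ x ∈ S, J G S a x) : Cn G S :=
  fun x hx y hy => (h x hx).symm.trans (h y hy)

theorem comp_Cn {G : SimpleGraph V} {S : Set V} {a : V} : Cn G (comp G S a) :=
  Cn_of fun _ h => comp_J h

theorem comp_self {G : SimpleGraph V} {S : Set V} {a : V} (h : a ∈ S) : a ∈ comp G S a := J.refl h

theorem comp_step {G : SimpleGraph V} {S : Set V} {a x y : V} (h : x ∈ comp G S a) (hy : y ∈ S)
    (hxy : G.Adj x y) : y ∈ comp G S a := J.step h hy hxy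

theorem Cn_insert {G : SimpleGraph V} {S : Set V} {x d : V} (h : Cn G S) (hd : d ∈ S)
    (hx : G.Adj d x) : Cn G (insert x S) := by
  apply Cn_of (a := d)
  intro y hy
  rcases hy with rfl | hy
  · exact J.adj (Set.mem_insert_of_mem _ hd) (Set.mem_insert _ _) hx
  · exact (h d hd y hy).mono (Set.subset_insert _ _)

theorem Cn_single {G : SimpleGraph V} (a : V) : Cn G {a} := by
  rintro x rfl y rfl
  exact J.refl rfl

/-- First hit of a set. -/
theorem trim [DecidableEq V] {G : SimpleGraph V} {S T : Set V} {a b : V} (h : J G S a b)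
    (hb : b ∈ T) :
    ∃ x ∈ T, ∃ P : G.Walk a x, P.IsPath ∧ (∀ z ∈ P.support, z ∈ S) ∧
      ∀ z ∈ P.support, z ∈ T → z = x := by
  classical
  obtain ⟨p, hp⟩ := h
  induction p with
  | nil => exact ⟨_, hb, Walk.nil, by simp, hp, by simp⟩
  | @cons u v' w' hadj p ih =>
    by_cases hu : u ∈ T
    · exact ⟨u, hu, Walk.nil, by simp, by simpa using hp u (by simp), by simp⟩
    · obtain ⟨x, hx, P, -, hPS, hPT⟩ := ih hb (fun x hx => hp x (by simp [hx]))
      refine ⟨x, hx, (Walk.cons hadj P).bypass, Walk.bypass_isPath _, ?_, ?_⟩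
      · intro z hz
        have := Walk.support_bypass_subset_support _ hz
        simp at this
        rcases this with rfl | h
        · exact hp _ (by simp)
        · exact hPS _ h
      · intro z hz hzT
        have := Walk.support_bypass_subset_support _ hz
        simp at this
        rcases this with rfl | h
        · exact absurd hzT hu
        · exact hPT _ h hzT

theorem J.path [DecidableEq V] {G : SimpleGraph V} {S : Set V} {a b : V} (h : J G S a b) :
    ∃ P : G.Walk a b, P.IsPath ∧ ∀ z ∈ P.support, z ∈ S := by
  obtain ⟨p, hp⟩ := h
  exact ⟨p.bypass, p.bypass_isPath, fun z hz => hp z (Walk.support_bypass_subset_support _ hz)⟩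

/-- Two disjoint connected sets joining the two sources to the two targets. -/
theorem linkage [Finite V] {G : SimpleGraph V} {D Y Z : Set V} {m1 m2 : V} (hm : m1 ≠ m2)
    (hD : Cn G D) (h1 : m1 ∈ D) (h2 : m2 ∈ D) (hY : ∃ y ∈ D, y ∈ Y) (hZ : ∃ z ∈ D, z ∈ Z)
    (hcut : ∀ (U : Set V) (t : V), U ⊆ D → t ∉ U → (m1 ∈ U ∨ m1 = t) → (m2 ∈ U ∨ m2 = t) →
      (∀ u ∈ U, ∀ x ∈ D, G.Adj u x → x ∈ U ∨ x = t) → ∃ u ∈ U, u ∈ Y ∨ u ∈ Z) :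
    ∃ (i j : V) (A1 A2 : Set V), ((i = m1 ∧ j = m2) ∨ (i = m2 ∧ j = m1)) ∧ A1 ⊆ D ∧ A2 ⊆ D ∧
      Disjoint A1 A2 ∧ Cn G A1 ∧ Cn G A2 ∧ i ∈ A1 ∧ j ∈ A2 ∧ (∃ y ∈ A1, y ∈ Y) ∧
      (∃ z ∈ A2, z ∈ Z) := by
  obtain ⟨y, hyD, hyY⟩ := hY
  obtain ⟨z, hzD, hzZ⟩ := hZ
  let P : Set V → Prop := fun A2 => ∃ (i j : V) (A1 : Set V),
      ((i = m1 ∧ j = m2) ∨ (i = m2 ∧ j = m1)) ∧ A1 ⊆ D ∧ A2 ⊆ D ∧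
      Disjoint A1 A2 ∧ Cn G A1 ∧ Cn G A2 ∧ i ∈ A1 ∧ j ∈ A2 ∧ (∃ y ∈ A1, y ∈ Y)
  have hex : ∃ A, P A := by
    by_cases c1 : ∃ y ∈ comp G (D \ {m2}) m1, y ∈ Y
    · exact ⟨{m2}, m1, m2, comp G (D \ {m2}) m1, Or.inl ⟨rfl, rfl⟩,
        comp_sub.trans Set.sdiff_subset, by simpa using h2,
        Set.disjoint_left.2 fun x hx hx' => (comp_sub hx).2 hx', comp_Cn, Cn_single _,
        comp_self ⟨h1, by simpa using hm⟩, rfl, c1⟩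
    by_cases c2 : ∃ y ∈ comp G (D \ {m1}) m2, y ∈ Y
    · exact ⟨{m1}, m2, m1, comp G (D \ {m1}) m2, Or.inr ⟨rfl, rfl⟩,
        comp_sub.trans Set.sdiff_subset, by simpa using h1,
        Set.disjoint_left.2 fun x hx hx' => (comp_sub hx).2 hx', comp_Cn, Cn_single _,
        comp_self ⟨h2, by simpa using hm.symm⟩, rfl, c2⟩
    exfalso
    have := (hD m1 h1 y hyD).closed (comp G (D \ {m2}) m1 ∪ comp G (D \ {m1}) m2)
      (Or.inl (comp_self ⟨h1, by simpa using hm⟩)) (by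
        rintro u (hu | hu) x hx hux
        · by_cases hxm : x = m2
          · subst hxm; exact Or.inr (comp_self ⟨h2, by simpa using hm.symm⟩)
          · exact Or.inl (comp_step hu ⟨hx, hxm⟩ hux)
        · by_cases hxm : x = m1
          · subst hxm; exact Or.inl (comp_self ⟨h1, by simpa using hm⟩)
          · exact Or.inr (comp_step hu ⟨hx, hxm⟩ hux))
    rcases this with h | h
    · exact c1 ⟨y, h, hyY⟩
    · exact c2 ⟨y, h, hyY⟩
  obtain ⟨A0, hA0⟩ := hex
  obtain ⟨A2, -, hA2, hmax⟩ := Set.Finite.exists_le_maximal (s := {A | P A}) (Set.toFinite _) hA0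
  obtain ⟨i, j, A1, hij, hA1D, hA2D, hdis, hc1, hc2, hi, hj, hy1⟩ := hA2
  have hdis' := Set.disjoint_left.1 hdis
  have hiA2 : i ∉ A2 := hdis' hi
  have hiD : i ∈ D := hA1D hi
  have hjD : j ∈ D := hA2D hj
  have hmaxI : ∀ t ∈ D, t ∉ A2 → (∃ a ∈ A2, G.Adj a t) → ∀ B : Set V, B ⊆ D → Cn G B → i ∈ B →
      (∃ y ∈ B, y ∈ Y) → Disjoint B A2 → t ∈ B := by
    rintro t htD htA ⟨a, haA, hat⟩ B hBD hB hiB hyB hBA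
    by_contra htB
    have : P (insert t A2) := by
      refine ⟨i, j, B, hij, hBD, Set.insert_subset htD hA2D, ?_, hB, Cn_insert hc2 haA hat, hiB,
        Set.mem_insert_of_mem _ hj, hyB⟩
      rw [Set.disjoint_left] at hBA ⊢
      rintro x hx (rfl | hx')
      · exact htB hx
      · exact hBA hx hx'
    exact htA (hmax this (Set.subset_insert _ _) (Set.mem_insert _ _))
  -- enlarge `A1` to the whole complement
  have hE : Cn G (D \ A2) := by
    apply Cn_of (a := i)
    intro x hx
    have := (hD i hiD x hx.1).closed (A2 ∪ {x | J G (D \ A2) i x}) (Or.inr (J.refl ⟨hiD, hiA2⟩)) (by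
      rintro u (hu | hu) x hx hux
      · by_cases hxA : x ∈ A2
        · exact Or.inl hxA
        · have := hmaxI x hx hxA ⟨u, hu, hux⟩ A1 hA1D hc1 hi hy1 hdis
          exact Or.inr ((hc1 i hi x this).mono fun z hz => ⟨hA1D hz, hdis' hz⟩)
      · by_cases hxA : x ∈ A2
        · exact Or.inl hxA
        · exact Or.inr (J.step hu ⟨hx, hxA⟩ hux))
    rcases this with h | h
    · exact absurd h hx.2
    · exact h
  have hED : D \ A2 ⊆ D := Set.sdiff_subset
  have hEd : Disjoint (D \ A2) A2 := Set.disjoint_left.2 fun x hx => hx.2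
  have hiE : i ∈ D \ A2 := ⟨hiD, hiA2⟩
  have hyE : ∃ y ∈ D \ A2, y ∈ Y := by
    obtain ⟨y, hy, hyY⟩ := hy1
    exact ⟨y, ⟨hA1D hy, hdis' hy⟩, hyY⟩
  by_cases cZ : ∃ z ∈ A2, z ∈ Z
  · exact ⟨i, j, D \ A2, A2, hij, hED, hA2D, hEd, hE, hc2, hiE, hj, hyE, cZ⟩
  have hzA : z ∉ A2 := fun h => cZ ⟨z, h, hzZ⟩
  by_cases cY : ∃ y ∈ A2, y ∈ Y
  · exact ⟨j, i, A2, D \ A2, by tauto, hA2D, hED, hEd.symm, hc2, hE, hj, hiE, cY,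
      ⟨z, ⟨hzD, hzA⟩, hzZ⟩⟩
  let U : V → Set V := fun t => comp G ((D \ A2) \ {t}) i
  let T : Set V := {t | t ∈ D \ A2 ∧ t ≠ i ∧ ∃ a ∈ A2, G.Adj a t}
  have hUD : ∀ t, U t ⊆ D := fun t => comp_sub.trans (Set.sdiff_subset.trans hED)
  have hUA : ∀ t, ∀ x ∈ U t, x ∉ A2 := fun t x hx => (comp_sub hx).1.2
  have htU : ∀ t, t ∉ U t := fun t ht => (comp_sub ht).2 rfl
  have hiU : ∀ t ∈ T, i ∈ U t := fun t ht => comp_self ⟨hiE, fun h => ht.2.1 h.symm⟩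
  have hUY : ∀ t ∈ T, ∀ y ∈ U t, y ∉ Y := by
    intro t ht y hy hyY
    exact htU t (hmaxI t ht.1.1 ht.1.2 ht.2.2 (U t) (hUD t) comp_Cn (hiU t ht) ⟨y, hy, hyY⟩
      (Set.disjoint_left.2 (hUA t)))
  have hm12 : ∀ S : Set V, ∀ t, (i ∈ S ∨ i = t) → (j ∈ S ∨ j = t) →
      (m1 ∈ S ∨ m1 = t) ∧ (m2 ∈ S ∨ m2 = t) := by
    intro S t h h'
    rcases hij with ⟨rfl, rfl⟩ | ⟨rfl, rfl⟩
    · exact ⟨h, h'⟩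
    · exact ⟨h', h⟩
  by_cases cU : ∃ t ∈ T, ∃ z ∈ U t, z ∈ Z
  · obtain ⟨t, ht, hz⟩ := cU
    refine ⟨j, i, D \ U t, U t, by tauto, Set.sdiff_subset, hUD t,
      Set.disjoint_left.2 fun x hx => hx.2, ?_, comp_Cn, ⟨hjD, fun h => hUA t _ h hj⟩, hiU t ht,
      ?_, hz⟩
    · obtain ⟨htE, hti, a, haA, hat⟩ := ht
      have htD : t ∈ D \ U t := ⟨htE.1, htU t⟩
      have hAs : A2 ⊆ D \ U t := fun x hx => ⟨hA2D hx, fun h => hUA t _ h hx⟩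
      apply Cn_of (a := t)
      intro x hx
      have := (hD t htE.1 x hx.1).closed (U t ∪ {x | J G (D \ U t) t x}) (Or.inr (J.refl htD)) (by
        rintro u (hu | hu) x hx hux
        · by_cases hxA : x ∈ A2
          · exact Or.inr ((J.adj htD (hAs haA) hat.symm).trans ((hc2 a haA x hxA).mono hAs))
          · by_cases hxt : x = t
            · subst hxt; exact Or.inr (J.refl htD)
            · exact Or.inl (comp_step hu ⟨⟨hx, hxA⟩, hxt⟩ hux)
        · by_cases hxU : x ∈ U t
          · exact Or.inl hxU
          · exact Or.inr (J.step hu ⟨hx, hxU⟩ hux))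
      rcases this with h | h
      · exact absurd h hx.2
      · exact h
    · obtain ⟨y, hy, hyY⟩ := hyE
      exact ⟨y, ⟨hy.1, fun h => hUY t ht y h hyY⟩, hyY⟩
  exfalso
  have hTne : ∃ t, t ∈ T := by
    by_contra hno
    push Not at hno
    obtain ⟨h, h'⟩ := hm12 A2 i (Or.inr rfl) (Or.inl hj)
    obtain ⟨u, hu, h⟩ := hcut A2 i hA2D hiA2 h h' (by
      intro u hu x hx hux
      by_contra hcon
      push Not at hcon
      exact hno x ⟨⟨hx, hcon.1⟩, hcon.2, u, hu, hux⟩)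
    rcases h with h | h
    · exact cY ⟨u, hu, h⟩
    · exact cZ ⟨u, hu, h⟩
  obtain ⟨t0, ht0⟩ := hTne
  obtain ⟨Ut, -, ⟨t, ht, rfl⟩, hUmax⟩ := Set.Finite.exists_le_maximal (s := Set.image U T) (Set.toFinite _)
    (Set.mem_image_of_mem U ht0)
  obtain ⟨h, h'⟩ := hm12 (U t ∪ A2) t (Or.inl (Or.inl (hiU t ht))) (Or.inl (Or.inr hj))
  obtain ⟨u, hu, hYZ⟩ := hcut (U t ∪ A2) t (Set.union_subset (hUD t) hA2D)
    (fun h => h.elim (htU t) ht.1.2) h h' (by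
      rintro u hu x hx hux
      by_cases hxt : x = t
      · exact Or.inr hxt
      by_cases hxA : x ∈ A2
      · exact Or.inl (Or.inr hxA)
      left; left
      rcases hu with hu | hu
      · exact comp_step hu ⟨⟨hx, hxA⟩, hxt⟩ hux
      by_contra hxU
      have hxi : x ≠ i := fun h => hxU (h ▸ hiU t ht)
      have hxT : x ∈ T := ⟨⟨hx, hxA⟩, hxi, u, hu, hux⟩
      have hsub : U t ⊆ U x := fun s hs => (comp_J hs).mono fun r hr =>
        ⟨(comp_sub hr).1, fun h => hxU (h ▸ hr)⟩
      have htx : t ∈ U x := by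
        have := (hE i hiE t ht.1).closed (U t ∪ {s | t ∈ U x}) (Or.inl (hiU t ht)) (by
          rintro u (hu | hu) s hs hus
          · by_cases hst : s = t
            · subst hst
              exact Or.inr (comp_step (hsub hu) ⟨hs, fun h => hxt h.symm⟩ hus)
            · exact Or.inl (comp_step hu ⟨hs, hst⟩ hus)
          · exact Or.inr hu)
        rcases this with h | h
        · exact absurd h (htU t)
        · exact h
      exact htU t (hUmax (Set.mem_image_of_mem U hxT) hsub htx))
  rcases hu with hu | hu
  · rcases hYZ with h | h
    · exact hUY t ht u hu h
    · exact cU ⟨t, ht, u, hu, h⟩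
  · rcases hYZ with h | h
    · exact cY ⟨u, hu, h⟩
    · exact cZ ⟨u, hu, h⟩


/-- The conclusion of the theorem for one interior link. -/
def Concl [DecidableEq V] (G : SimpleGraph V) (m1 m2 v w : V) : Prop :=
    ∃ (a b : V) (F : G.Walk a a) (C : G.Walk b b),
      F.IsCycle ∧ C.IsCycle ∧ s(v, w) ∈ F.edges ∧ s(v, w) ∈ C.edges ∧
      NonSeparatingCycle G m1 m2 F ∧
      (F.support.toFinset ∩ C.support.toFinset).card ≤ 3 ∧
      ∃ p : V × V, (p = (m1, m2) ∨ p = (m2, m1)) ∧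
      ∃ (x y : V) (P1 : G.Walk p.1 x) (P2 : G.Walk p.2 y),
        P1.IsPath ∧ P2.IsPath ∧
        x ∈ F.support ∧ x ≠ v ∧ x ≠ w ∧
        y ∈ C.support ∧ y ≠ v ∧ y ≠ w ∧
        (∀ z, z ∈ P1.support → z ∉ P2.support) ∧
        v ∉ P1.support ∧ w ∉ P1.support ∧ v ∉ P2.support ∧ w ∉ P2.support ∧
        (P1.support.toFinset ∩ F.support.toFinset).card = 1 ∧
        (P2.support.toFinset ∩ C.support.toFinset).card = 1

/-- The standing assumptions: `Γ = G + m1m2`, `G0 = G - vw`. -/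
structure Ctx (G G0 Γ : SimpleGraph V) (m1 m2 v w : V) : Prop where
  hm : m1 ≠ m2
  hΓ : ∀ a b, Γ.Adj a b ↔ G.Adj a b ∨ (a = m1 ∧ b = m2) ∨ (a = m2 ∧ b = m1)
  h0 : ∀ a b, G0.Adj a b ↔ G.Adj a b ∧ s(a, b) ≠ s(v, w)
  hvw : G.Adj v w
  v1 : v ≠ m1
  v2 : v ≠ m2
  w1 : w ≠ m1
  w2 : w ≠ m2
  four : ∀ a b c : V, ∃ d, d ≠ a ∧ d ≠ b ∧ d ≠ c
  K : ∀ (U : Set V) (s t y u0 : V), u0 ∈ U → s ∉ U → t ∉ U → y ∉ U → y ≠ s → y ≠ t →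
    ∃ u ∈ U, ∃ x, x ∉ U ∧ x ≠ s ∧ x ≠ t ∧ Γ.Adj u x
  cut : ∀ (U : Set V) (a b : V), v ∈ U → w ∉ U → a ∈ U → b ∉ U →
    ∃ x ∈ U, ∃ y, y ∉ U ∧ G.Adj x y ∧ s(x, y) ≠ s(v, w) ∧ ¬ (x = a ∧ y = b)

theorem Ctx.swapm {G G0 Γ : SimpleGraph V} {m1 m2 v w : V} (c : Ctx G G0 Γ m1 m2 v w) :
    Ctx G G0 Γ m2 m1 v w :=
  { hm := c.hm.symm
    hΓ := fun a b => by rw [c.hΓ]; tauto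
    h0 := c.h0
    hvw := c.hvw
    v1 := c.v2
    v2 := c.v1
    w1 := c.w2
    w2 := c.w1
    four := c.four
    K := c.K
    cut := c.cut }

theorem Ctx.swapv {G G0 Γ : SimpleGraph V} {m1 m2 v w : V} (c : Ctx G G0 Γ m1 m2 v w) :
    Ctx G G0 Γ m1 m2 w v :=
  { hm := c.hm
    hΓ := c.hΓ
    h0 := fun a b => by rw [c.h0, Sym2.eq_swap (a := w)]
    hvw := c.hvw.symm
    v1 := c.w1
    v2 := c.w2
    w1 := c.v1
    w2 := c.v2
    four := c.four
    K := c.K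
    cut := by
      intro U a b hw hv ha hb
      obtain ⟨x, hx, y, hy, hxy, hne, hab⟩ := c.cut Uᶜ b a hv (fun h => h hw) hb (fun h => h ha)
      refine ⟨y, not_not.1 hy, x, hx, hxy.symm, ?_, fun h => hab ⟨h.2, h.1⟩⟩
      rw [Sym2.eq_swap, Sym2.eq_swap (a := w)]
      exact hne }

theorem Ctx.g0 {G G0 Γ : SimpleGraph V} {m1 m2 v w : V} (c : Ctx G G0 Γ m1 m2 v w) {a b : V}
    (h : G.Adj a b) (hv : a ≠ v) (hw : a ≠ w) : G0.Adj a b := by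
  rw [c.h0]
  refine ⟨h, fun h => ?_⟩
  rw [Sym2.eq_iff] at h
  tauto

theorem Ctx.g0_le {G G0 Γ : SimpleGraph V} {m1 m2 v w : V} (c : Ctx G G0 Γ m1 m2 v w) :
    G0 ≤ G := fun a b h => ((c.h0 a b).1 h).1

theorem Ctx.toG {G G0 Γ : SimpleGraph V} {m1 m2 v w : V} (c : Ctx G G0 Γ m1 m2 v w) {a b : V}
    (h : Γ.Adj a b) (h1 : ¬ (a = m1 ∧ b = m2)) (h2 : ¬ (a = m2 ∧ b = m1)) : G.Adj a b := by
  rw [c.hΓ] at h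
  tauto

theorem Ctx.ofG {G G0 Γ : SimpleGraph V} {m1 m2 v w : V} (c : Ctx G G0 Γ m1 m2 v w) {a b : V}
    (h : G.Adj a b) : Γ.Adj a b := by
  rw [c.hΓ]
  exact Or.inl h

/-- Sub-segments of a walk. -/
theorem seg {G : SimpleGraph V} {v w : V} (Q : G.Walk v w) (i j : ℕ) (hij : i ≤ j)
    (hj : j ≤ Q.length) :
    J G {x | ∃ k, i ≤ k ∧ k ≤ j ∧ x = Q.getVert k} (Q.getVert i) (Q.getVert j) := by
  induction j, hij using Nat.le_induction with
  | base => exact J.refl ⟨i, le_refl _, le_refl _, rfl⟩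
  | succ j hij ih =>
    have := (ih (by omega)).mono (T := {x | ∃ k, i ≤ k ∧ k ≤ j + 1 ∧ x = Q.getVert k})
      (by rintro x ⟨k, h1, h2, h3⟩; exact ⟨k, h1, by omega, h3⟩)
    exact this.step ⟨j + 1, by omega, le_refl _, rfl⟩ (Q.adj_getVert_succ (by omega))

theorem gv_inj {G : SimpleGraph V} {v w : V} {Q : G.Walk v w} (hQ : Q.IsPath) {i j : ℕ}
    (hi : i ≤ Q.length) (hj : j ≤ Q.length) (h : Q.getVert i = Q.getVert j) : i = j :=
  hQ.getVert_injOn hi hj h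

theorem bypass0 {G : SimpleGraph V} {v w : V} {Q : G.Walk v w} (hQ : Q.IsPath) {E : Set V}
    (hE : ∀ x ∈ Q.support, x ∈ E) {i j k : ℕ} (hij : i < j) (hjk : j < k) (hk : k ≤ Q.length)
    (h : J G (E \ {Q.getVert j}) (Q.getVert i) (Q.getVert k)) :
    J G (E \ {Q.getVert j}) v w := by
  have h1 := (seg Q 0 i (by omega) (by omega)).mono (T := E \ {Q.getVert j}) (by
    rintro x ⟨l, h1, h2, rfl⟩
    refine ⟨hE _ (Q.getVert_mem_support _), fun h => ?_⟩
    have := gv_inj hQ (by omega) (by omega) h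
    omega)
  have h2 := (seg Q k Q.length hk (le_refl _)).mono (T := E \ {Q.getVert j}) (by
    rintro x ⟨l, h1, h2, rfl⟩
    refine ⟨hE _ (Q.getVert_mem_support _), fun h => ?_⟩
    have := gv_inj hQ (by omega) (by omega) h
    omega)
  rw [Q.getVert_zero] at h1
  rw [Q.getVert_length] at h2
  exact h1.trans (h.trans h2)

/-- The outcome of the maximality argument: the complement of `D` is an induced cycle. -/
structure Good (G G0 Γ : SimpleGraph V) (m1 m2 v w : V) (D : Set V) : Prop where
  mon : m1 ∈ D ∨ m2 ∈ D
  vD : v ∉ D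
  wD : w ∉ D
  conn : Cn Γ D
  join : J G0 Dᶜ v w
  nb : ∀ x, x ∉ D → x ≠ v → x ≠ w → ∃ d ∈ D, Γ.Adj d x
  sep : ∀ x, x ∉ D → x ≠ v → x ≠ w → ¬ J G0 (Dᶜ \ {x}) v w
  vn : ∃ d ∈ D, G.Adj v d
  wn : ∃ d ∈ D, G.Adj w d

theorem vnb [DecidableEq V] {G G0 Γ : SimpleGraph V} {m1 m2 v w : V} (c : Ctx G G0 Γ m1 m2 v w)
    {D : Set V}
    (join : J G0 Dᶜ v w) (sep : ∀ x, x ∉ D → x ≠ v → x ≠ w → ¬ J G0 (Dᶜ \ {x}) v w) :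
    ∃ d ∈ D, G.Adj v d := by
  obtain ⟨Q, hQ, hQD⟩ := join.path
  have hvw : v ≠ w := c.hvw.ne
  have hlen : 0 < Q.length := by
    rcases Nat.eq_zero_or_pos Q.length with h | h
    · exact absurd (Walk.eq_of_length_eq_zero h) hvw
    · exact h
  have hadj : G0.Adj v (Q.getVert 1) := by
    have := Q.adj_getVert_succ hlen
    rwa [Q.getVert_zero] at this
  have h1w : Q.getVert 1 ≠ w := by
    intro h
    rw [h] at hadj
    exact ((c.h0 _ _).1 hadj).2 rfl
  obtain ⟨y, hy1, hy2, hy3⟩ := c.four v (Q.getVert 1) w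
  obtain ⟨u, hu, x, hxv, hx1, hxw, hux⟩ := c.K {v} (Q.getVert 1) w y v rfl (fun h => hadj.ne h.symm)
    (fun h => hvw h.symm) hy1 hy2 hy3
  have huv : u = v := hu
  subst huv
  have hxv' : x ≠ u := hxv
  have hGux : G.Adj u x := c.toG hux (fun h => c.v1 h.1) (fun h => c.v2 h.1)
  by_cases hxD : x ∈ D
  · exact ⟨x, hxD, hGux⟩
  exfalso
  have hxQ : x ∈ Q.support := by
    by_contra hxQ
    exact sep x hxD hxv' hxw ⟨Q, fun z hz => ⟨hQD z hz, fun h => hxQ (h ▸ hz)⟩⟩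
  obtain ⟨k, rfl, hk⟩ := Walk.mem_support_iff_exists_getVert.1 hxQ
  have hk0 : k ≠ 0 := by
    rintro rfl; exact hxv' Q.getVert_zero
  have hk1 : k ≠ 1 := by
    rintro rfl; exact hx1 rfl
  apply sep (Q.getVert 1) (hQD _ (Q.getVert_mem_support _)) hadj.ne.symm h1w
  apply bypass0 hQ hQD (i := 0) (j := 1) (k := k) (by omega) (by omega) hk
  rw [Q.getVert_zero]
  refine J.adj ⟨hQD _ Q.start_mem_support, hadj.ne⟩ ⟨hxD, hx1⟩ ?_
  exact (c.g0 hGux.symm hxv' hxw).symm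

theorem exists_good [Finite V] [DecidableEq V] {G G0 Γ : SimpleGraph V} {m1 m2 v w : V}
    (c : Ctx G G0 Γ m1 m2 v w)
    {D0 : Set V} (mon : m1 ∈ D0 ∨ m2 ∈ D0) (hv : v ∉ D0) (hw : w ∉ D0) (hc : Cn Γ D0)
    (hj : J G0 D0ᶜ v w) : ∃ D, D0 ⊆ D ∧ Good G G0 Γ m1 m2 v w D := by
  obtain ⟨D, hD0, ⟨vD, wD, hconn, join⟩, hmax⟩ := Set.Finite.exists_le_maximal
    (s := {D : Set V | v ∉ D ∧ w ∉ D ∧ Cn Γ D ∧ J G0 Dᶜ v w}) (Set.toFinite _)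
    (a := D0) ⟨hv, hw, hc, hj⟩
  have hD0' : D0 ⊆ D := hD0
  have monD : m1 ∈ D ∨ m2 ∈ D := mon.imp (fun h => hD0' h) (fun h => hD0' h)
  have sepN : ∀ x, x ∉ D → x ≠ v → x ≠ w → (∃ d ∈ D, Γ.Adj d x) → ¬ J G0 (Dᶜ \ {x}) v w := by
    rintro x hx hxv hxw ⟨d, hd, hdx⟩ hJ
    refine hx (hmax (y := insert x D) ⟨?_, ?_, Cn_insert hconn hd hdx, hJ.mono ?_⟩
      (Set.subset_insert _ _) (Set.mem_insert _ _))
    · rintro (h | h)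
      · exact hxv h.symm
      · exact vD h
    · rintro (h | h)
      · exact hxw h.symm
      · exact wD h
    · rintro z ⟨hz, hzx⟩ (h | h)
      · exact hzx h
      · exact hz h
  obtain ⟨Q, hQ, hQD⟩ := join.path
  have onQ : ∀ x, x ∉ D → (∃ d ∈ D, Γ.Adj d x) → x ∈ Q.support := by
    intro x hx hd
    by_cases hxv : x = v
    · subst hxv; exact Q.start_mem_support
    by_cases hxw : x = w
    · subst hxw; exact Q.end_mem_support
    by_contra hxQ
    exact sepN x hx hxv hxw hd ⟨Q, fun z hz => ⟨hQD z hz, fun h => hxQ (h ▸ hz)⟩⟩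
  have toG0 : ∀ a b, a ∉ D → b ∉ D → a ≠ v → a ≠ w → Γ.Adj a b → G0.Adj a b := by
    intro a b ha hb hav haw hab
    refine c.g0 (c.toG hab ?_ ?_) hav haw
    · rintro ⟨rfl, rfl⟩; tauto
    · rintro ⟨rfl, rfl⟩; tauto
  have nb : ∀ x, x ∉ D → x ≠ v → x ≠ w → ∃ d ∈ D, Γ.Adj d x := by
    intro x hx hxv hxw
    by_contra hno
    let R : Set V := {y | y ∉ D ∧ y ≠ v ∧ y ≠ w ∧ ¬ ∃ d ∈ D, Γ.Adj d y}
    let L := comp Γ R x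
    have hxL : x ∈ L := comp_self ⟨hx, hxv, hxw, hno⟩
    have hLR : L ⊆ R := comp_sub
    have hLc : Cn Γ L := comp_Cn
    obtain ⟨d, hd⟩ : ∃ d, d ∈ D := by
      rcases monD with h | h
      · exact ⟨_, h⟩
      · exact ⟨_, h⟩
    have hdL : d ∉ L := fun h => (hLR h).1 hd
    have nbL : ∀ u ∈ L, ∀ y, y ∉ L → Γ.Adj u y → y ∉ D ∧ y ∈ Q.support := by
      intro u hu y hy huy
      have hyD : y ∉ D := fun h => (hLR hu).2.2.2 ⟨y, h, huy.symm⟩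
      refine ⟨hyD, ?_⟩
      by_contra hyQ
      apply hy
      refine comp_step hu ⟨hyD, ?_, ?_, fun h => hyQ (onQ y hyD h)⟩ huy
      · rintro rfl; exact hyQ Q.start_mem_support
      · rintro rfl; exact hyQ Q.end_mem_support
    have ne_d : ∀ y, y ∉ D → d ≠ y := by
      rintro y hy rfl; exact hy hd
    have hvL : v ∉ L := fun h => (hLR h).2.1 rfl
    obtain ⟨u1, hu1, t1, ht1, -, -, a1⟩ := c.K L v v d x hxL hvL hvL hdL (ne_d v vD) (ne_d v vD)
    obtain ⟨t1D, t1Q⟩ := nbL u1 hu1 t1 ht1 a1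
    obtain ⟨u2, hu2, t2, ht2, h21, -, a2⟩ := c.K L t1 t1 d x hxL ht1 ht1 hdL (ne_d _ t1D) (ne_d _ t1D)
    obtain ⟨t2D, t2Q⟩ := nbL u2 hu2 t2 ht2 a2
    obtain ⟨u3, hu3, t3, ht3, h31, h32, a3⟩ :=
      c.K L t1 t2 d x hxL ht1 ht2 hdL (ne_d _ t1D) (ne_d _ t2D)
    obtain ⟨t3D, t3Q⟩ := nbL u3 hu3 t3 ht3 a3
    have main : ∀ i j k : ℕ, i < j → j < k → k ≤ Q.length →
        (∃ u ∈ L, Γ.Adj u (Q.getVert i)) → (∃ u ∈ L, Γ.Adj u (Q.getVert j)) →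
        (∃ u ∈ L, Γ.Adj u (Q.getVert k)) → Q.getVert j ∉ L → False := by
      rintro i j k hij hjk hk ⟨ui, hui, ai⟩ ⟨uj, huj, aj⟩ ⟨uk, huk, ak⟩ hjL
      have hjv : Q.getVert j ≠ v := by
        intro h
        have := gv_inj hQ (i := j) (j := 0) (by omega) (by omega) (by rw [h, Q.getVert_zero])
        omega
      have hjw : Q.getVert j ≠ w := by
        intro h
        have := gv_inj hQ (i := j) (j := Q.length) (by omega) (by omega)
          (by rw [h, Q.getVert_length])
        omega
      have hjD : Q.getVert j ∉ D := hQD _ (Q.getVert_mem_support _)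
      have hiD : Q.getVert i ∉ D := hQD _ (Q.getVert_mem_support _)
      have hkD : Q.getVert k ∉ D := hQD _ (Q.getVert_mem_support _)
      have hjN : ∃ d ∈ D, Γ.Adj d (Q.getVert j) := by
        by_contra h
        exact hjL (comp_step huj ⟨hjD, hjv, hjw, h⟩ aj)
      apply sepN _ hjD hjv hjw hjN
      apply bypass0 hQ hQD hij hjk hk
      have hLs : L ⊆ Dᶜ \ {Q.getVert j} := fun z hz => ⟨(hLR hz).1, fun h => hjL (h ▸ hz)⟩
      have hi' : Q.getVert i ∈ Dᶜ \ {Q.getVert j} := ⟨hiD, fun h => by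
        have := gv_inj hQ (by omega) (by omega) h
        omega⟩
      have hk' : Q.getVert k ∈ Dᶜ \ {Q.getVert j} := ⟨hkD, fun h => by
        have := gv_inj hQ (by omega) (by omega) h
        omega⟩
      have e1 : G0.Adj ui (Q.getVert i) := toG0 _ _ (hLR hui).1 hiD (hLR hui).2.1 (hLR hui).2.2.1 ai
      have e2 : G0.Adj uk (Q.getVert k) := toG0 _ _ (hLR huk).1 hkD (hLR huk).2.1 (hLR huk).2.2.1 ak
      have e3 : J G0 (Dᶜ \ {Q.getVert j}) ui uk := (hLc ui hui uk huk).mono' hLs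
        (fun a ha b hb hab => toG0 _ _ (hLR ha).1 (hLR hb).1 (hLR ha).2.1 (hLR ha).2.2.1 hab)
      exact ((J.adj hi' (hLs hui) e1.symm).trans e3).step hk' e2
    obtain ⟨i1, rfl, hi1⟩ := Walk.mem_support_iff_exists_getVert.1 t1Q
    obtain ⟨i2, rfl, hi2⟩ := Walk.mem_support_iff_exists_getVert.1 t2Q
    obtain ⟨i3, rfl, hi3⟩ := Walk.mem_support_iff_exists_getVert.1 t3Q
    have n21 : i2 ≠ i1 := fun h => h21 (by rw [h])
    have n31 : i3 ≠ i1 := fun h => h31 (by rw [h])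
    have n32 : i3 ≠ i2 := fun h => h32 (by rw [h])
    have b1 : ∃ u ∈ L, Γ.Adj u (Q.getVert i1) := ⟨u1, hu1, a1⟩
    have b2 : ∃ u ∈ L, Γ.Adj u (Q.getVert i2) := ⟨u2, hu2, a2⟩
    have b3 : ∃ u ∈ L, Γ.Adj u (Q.getVert i3) := ⟨u3, hu3, a3⟩
    rcases lt_or_gt_of_ne n21 with h | h <;> rcases lt_or_gt_of_ne n31 with h' | h' <;>
      rcases lt_or_gt_of_ne n32 with hgt | hgt
    · exact main i3 i2 i1 hgt h hi1 b3 b2 b1 ht2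
    · exact main i2 i3 i1 hgt h' hi1 b2 b3 b1 ht3
    · omega
    · exact main i2 i1 i3 h h' hi3 b2 b1 b3 ht1
    · exact main i3 i1 i2 h' h hi2 b3 b1 b2 ht1
    · omega
    · exact main i1 i3 i2 h' hgt hi2 b1 b3 b2 ht3
    · exact main i1 i2 i3 h hgt hi3 b1 b2 b3 ht2
  have sep : ∀ x, x ∉ D → x ≠ v → x ≠ w → ¬ J G0 (Dᶜ \ {x}) v w :=
    fun x hx hxv hxw => sepN x hx hxv hxw (nb x hx hxv hxw)
  exact ⟨D, hD0, monD, vD, wD, hconn, join, nb, sep, vnb c join sep,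
    vnb c.swapv join.symm (fun x hx hxw hxv h => sep x hx hxv hxw h.symm)⟩

/-- The closing step: assemble the cycles and the paths. -/
theorem fin [DecidableEq V] {G G0 Γ : SimpleGraph V} {m1 m2 v w : V}
    (c : Ctx G G0 Γ m1 m2 v w) {D : Set V} (g : Good G G0 Γ m1 m2 v w D)
    {i j : V} (hij : (i = m1 ∧ j = m2) ∨ (i = m2 ∧ j = m1))
    {S S1 S2 : Set V} {a b r x d : V} (hab : J G S a b) (hva : G.Adj v a) (hbw : G.Adj b w)
    (hvS : v ∉ S) (hwS : w ∉ S) (hSr : ∀ z ∈ S, z ∉ D → z = r)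
    (hd : d = a ∨ d = b) (h1 : J G S1 i x) (hxD : x ∉ D) (h2 : J G S2 j d)
    (hdis : ∀ z ∈ S1, z ∉ S2) (hv1 : v ∉ S1) (hw1 : w ∉ S1) (hv2 : v ∉ S2) (hw2 : w ∉ S2) :
    Concl G m1 m2 v w := by
  have hvw : v ≠ w := c.hvw.ne
  obtain ⟨QF, hQF, hQFD⟩ := g.join.path
  have hQFs : ∀ z, z ∈ QF.support ↔ z ∉ D := by
    intro z
    refine ⟨fun h => hQFD z h, fun hz => ?_⟩
    by_cases hzv : z = v
    · subst hzv; exact QF.start_mem_support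
    by_cases hzw : z = w
    · subst hzw; exact QF.end_mem_support
    by_contra hzQ
    exact g.sep z hz hzv hzw ⟨QF, fun y hy => ⟨hQFD y hy, fun h => hzQ (h ▸ hy)⟩⟩
  have hab0 : J G0 S a b := hab.mono' (le_refl _) (fun y hy z hz h =>
    c.g0 h (fun h => hvS (h ▸ hy)) (fun h => hwS (h ▸ hy)))
  obtain ⟨p, hp, hpS⟩ := hab0.path
  have haS := hab.left
  have hbS := hab.right
  have hva0 : G0.Adj v a := (c.g0 hva.symm (fun h => hvS (h ▸ haS)) (fun h => hwS (h ▸ haS))).symm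
  have hbw0 : G0.Adj b w := c.g0 hbw (fun h => hvS (h ▸ hbS)) (fun h => hwS (h ▸ hbS))
  let QC : G0.Walk v w := Walk.cons hva0 (p.concat hbw0)
  have hQCs : ∀ z, z ∈ QC.support ↔ z = v ∨ z ∈ p.support ∨ z = w := by
    intro z
    simp [QC, Walk.support_concat]
  have hQC : QC.IsPath := by
    rw [Walk.cons_isPath_iff]
    refine ⟨hp.concat (fun h => hwS (hpS _ h)) hbw0, ?_⟩
    intro h
    simp [Walk.support_concat] at h
    rcases h with h | h
    · exact hvS (hpS _ h)
    · exact hvw h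
  have cyc : ∀ Q : G0.Walk v w, Q.IsPath → ∃ C : G.Walk w w, C.IsCycle ∧ s(v, w) ∈ C.edges ∧
      ∀ z, z ∈ C.support ↔ z ∈ Q.support := by
    intro Q hQ
    refine ⟨Walk.cons c.hvw.symm (Q.mapLe c.g0_le), ?_, ?_, ?_⟩
    · rw [Walk.cons_isCycle_iff]
      refine ⟨hQ.mapLe _, ?_⟩
      rw [Walk.edges_mapLe_eq_edges]
      intro h
      have := Q.adj_of_mem_edges h
      exact ((c.h0 _ _).1 this).2 Sym2.eq_swap
    · simp [Sym2.eq_swap]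
    · intro z
      rw [Walk.support_cons, Walk.support_mapLe_eq_support, List.mem_cons]
      refine ⟨?_, Or.inr⟩
      rintro (rfl | h)
      · exact Q.end_mem_support
      · exact h
  obtain ⟨F, hF, hFe, hFs⟩ := cyc QF hQF
  obtain ⟨C, hC, hCe, hCs⟩ := cyc QC hQC
  have hFD : ∀ z, z ∈ F.support ↔ z ∉ D := fun z => (hFs z).trans (hQFs z)
  have hdC : d ∈ C.support := by
    rw [hCs, hQCs]
    rcases hd with rfl | rfl
    · exact Or.inr (Or.inl p.start_mem_support)
    · exact Or.inr (Or.inl p.end_mem_support)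
  obtain ⟨x', hx', P1, hP1, hP1S, hP1T⟩ := trim h1 (T := {z | z ∈ F.support}) ((hFD x).2 hxD)
  obtain ⟨y', hy', P2, hP2, hP2S, hP2T⟩ := trim h2 (T := {z | z ∈ C.support}) hdC
  have hx1 := hP1S _ P1.end_mem_support
  have hy2 := hP2S _ P2.end_mem_support
  refine ⟨w, w, F, C, hF, hC, hFe, hCe, ?_, ?_, (i, j), ?_, x', y', P1, P2, hP1, hP2, hx',
    fun h => hv1 (h ▸ hx1), fun h => hw1 (h ▸ hx1), hy',
    fun h => hv2 (h ▸ hy2), fun h => hw2 (h ▸ hy2), fun z hz hz' => hdis z (hP1S z hz) (hP2S z hz'),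
    fun h => hv1 (hP1S _ h), fun h => hw1 (hP1S _ h), fun h => hv2 (hP2S _ h),
    fun h => hw2 (hP2S _ h), ?_, ?_⟩
  · -- non-separating
    rintro ⟨z, hz⟩
    have hzD : z ∈ D := by
      by_contra h; exact hz ((hFD z).2 h)
    have key : ∃ y, (y = m1 ∨ y = m2) ∧ J G D z y := by
      obtain ⟨m, hmD, hm⟩ : ∃ m ∈ D, m = m1 ∨ m = m2 := by
        rcases g.mon with h | h
        · exact ⟨_, h, Or.inl rfl⟩
        · exact ⟨_, h, Or.inr rfl⟩
      have := (g.conn m hmD z hzD).closed {t | t ∈ D ∧ ∃ y, (y = m1 ∨ y = m2) ∧ J G D t y}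
        ⟨hmD, m, hm, J.refl hmD⟩ (by
          rintro s ⟨hs, y, hy, hsy⟩ t ht hst
          refine ⟨ht, ?_⟩
          rw [c.hΓ] at hst
          rcases hst with h | ⟨-, h⟩ | ⟨-, h⟩
          · exact ⟨y, hy, (J.adj ht hs h.symm).trans hsy⟩
          · exact ⟨t, Or.inr h, J.refl ht⟩
          · exact ⟨t, Or.inl h, J.refl ht⟩)
      exact this.2
    obtain ⟨y, hy, p, hp⟩ := key
    have hp' : ∀ t ∈ p.support, t ∈ {t | t ∉ F.support} := by
      intro t ht h
      exact (hFD t).1 h (hp t ht)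
    exact ⟨⟨y, hp' y p.end_mem_support⟩, hy, ⟨p.induce _ hp'⟩⟩
  · calc _ ≤ ({v, w, r} : Finset V).card := Finset.card_le_card (by
          intro z hz
          simp only [Finset.mem_inter, List.mem_toFinset] at hz
          obtain ⟨hzF, hzC⟩ := hz
          rw [hCs, hQCs] at hzC
          rw [hFD] at hzF
          simp only [Finset.mem_insert, Finset.mem_singleton]
          rcases hzC with h | h | h
          · exact Or.inl h
          · exact Or.inr (Or.inr (hSr z (hpS z h) hzF))
          · exact Or.inr (Or.inl h))
      _ ≤ 3 := Finset.card_le_three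
  · rcases hij with ⟨rfl, rfl⟩ | ⟨rfl, rfl⟩
    · exact Or.inl rfl
    · exact Or.inr rfl
  · rw [Finset.card_eq_one]
    refine ⟨x', ?_⟩
    ext z
    simp only [Finset.mem_inter, List.mem_toFinset, Finset.mem_singleton]
    refine ⟨fun h => hP1T z h.1 h.2, ?_⟩
    rintro rfl
    exact ⟨P1.end_mem_support, hx'⟩
  · rw [Finset.card_eq_one]
    refine ⟨y', ?_⟩
    ext z
    simp only [Finset.mem_inter, List.mem_toFinset, Finset.mem_singleton]
    refine ⟨fun h => hP2T z h.1 h.2, ?_⟩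
    rintro rfl
    exact ⟨P2.end_mem_support, hy'⟩


theorem Concl.swapm [DecidableEq V] {G : SimpleGraph V} {m1 m2 v w : V}
    (h : Concl G m2 m1 v w) : Concl G m1 m2 v w := by
  obtain ⟨a, b, F, C, h1, h2, h3, h4, h5, h6, p, hp, h7⟩ := h
  refine ⟨a, b, F, C, h1, h2, h3, h4, ?_, h6, p, hp.symm, h7⟩
  intro x
  obtain ⟨y, hy, hr⟩ := h5 x
  exact ⟨y, hy.symm, hr⟩

theorem Good.swapm {G G0 Γ : SimpleGraph V} {m1 m2 v w : V} {D : Set V}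
    (g : Good G G0 Γ m1 m2 v w D) : Good G G0 Γ m2 m1 v w D :=
  { mon := g.mon.symm
    vD := g.vD
    wD := g.wD
    conn := g.conn
    join := g.join
    nb := g.nb
    sep := g.sep
    vn := g.vn
    wn := g.wn }

theorem Good.X {G G0 Γ : SimpleGraph V} {m1 m2 v w : V} (c : Ctx G G0 Γ m1 m2 v w) {D : Set V}
    (g : Good G G0 Γ m1 m2 v w D) : ∃ x, x ∉ D ∧ x ≠ v ∧ x ≠ w := by
  by_contra hX
  push Not at hX
  have : w ∈ ({v} : Set V) := g.join.closed {v} rfl (by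
    rintro x rfl y hy hxy
    by_contra hne
    have := hX y hy hne
    subst this
    exact ((c.h0 _ _).1 hxy).2 rfl)
  exact c.hvw.ne this.symm

theorem Good.xnb {G G0 Γ : SimpleGraph V} {m1 m2 v w : V} (c : Ctx G G0 Γ m1 m2 v w) {D : Set V}
    (g : Good G G0 Γ m1 m2 v w D) (h1 : m1 ∈ D) (h2 : m2 ∈ D) {x : V} (hx : x ∉ D)
    (hv : x ≠ v) (hw : x ≠ w) : ∃ d ∈ D, G.Adj d x := by
  obtain ⟨d, hd, hdx⟩ := g.nb x hx hv hw
  exact ⟨d, hd, c.toG hdx (fun h => hx (h.2 ▸ h2)) (fun h => hx (h.2 ▸ h1))⟩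

/-- Only one monitor lies in `D`. -/
theorem case1 [DecidableEq V] {G G0 Γ : SimpleGraph V} {m1 m2 v w : V}
    (c : Ctx G G0 Γ m1 m2 v w) {D : Set V} (g : Good G G0 Γ m1 m2 v w D) (h1 : m1 ∉ D) :
    Concl G m1 m2 v w := by
  have h2 : m2 ∈ D := g.mon.resolve_left h1
  have hD : Cn G D := fun a ha b hb => (g.conn a ha b hb).mono' (le_refl _) (fun x hx y hy h =>
    c.toG h (fun h => h1 (h.1 ▸ hx)) (fun h => h1 (h.2 ▸ hy)))
  obtain ⟨a, ha, hva⟩ := g.vn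
  obtain ⟨b, hb, hwb⟩ := g.wn
  refine fin c g (Or.inl ⟨rfl, rfl⟩) (S := D) (S1 := {m1}) (S2 := D) (r := v) (hD a ha b hb) hva
    hwb.symm g.vD g.wD (fun z hz hz' => absurd hz hz') (Or.inl rfl) (J.refl rfl) h1
    (hD _ h2 _ ha) ?_ c.v1 c.w1 g.vD g.wD
  rintro z rfl
  exact h1

theorem Good.split {G G0 Γ : SimpleGraph V} {m1 m2 v w : V} (c : Ctx G G0 Γ m1 m2 v w)
    {D : Set V} (g : Good G G0 Γ m1 m2 v w D) (h1 : m1 ∈ D) (h2 : m2 ∈ D) {z : V} (hz : z ∈ D) :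
    z ∈ comp G D m1 ∨ z ∈ comp G D m2 := by
  refine (g.conn m1 h1 z hz).closed (comp G D m1 ∪ comp G D m2) (Or.inl (comp_self h1)) ?_
  intro x hx y hy hxy
  rcases (c.hΓ _ _).1 hxy with h | ⟨_, rfl⟩ | ⟨_, rfl⟩
  · exact hx.imp (fun hx => comp_step hx hy h) (fun hx => comp_step hx hy h)
  · exact Or.inr (comp_self h2)
  · exact Or.inl (comp_self h1)

/-- Both monitors lie in `D` and `D` is connected in `G`. -/
theorem case2a [Finite V] [DecidableEq V] {G G0 Γ : SimpleGraph V} {m1 m2 v w : V}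
    (c : Ctx G G0 Γ m1 m2 v w) {D : Set V} (g : Good G G0 Γ m1 m2 v w D) (h1 : m1 ∈ D)
    (hJ : J G D m1 m2) : Concl G m1 m2 v w := by
  have h2 : m2 ∈ D := hJ.right
  have hD : Cn G D := Cn_of (a := m1) fun x hx => (g.split c h1 h2 hx).elim id
    (fun h => hJ.trans h)
  obtain ⟨x0, hx0, hx0v, hx0w⟩ := g.X c
  obtain ⟨d0, hd0, hdx0⟩ := g.xnb c h1 h2 hx0 hx0v hx0w
  obtain ⟨a, ha, hva⟩ := g.vn
  obtain ⟨b, hb, hwb⟩ := g.wn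
  obtain ⟨i, j, A1, A2, hij, hA1, hA2, hdis, hc1, hc2, hi, hj, ⟨y, hyA, x, hx, hxv, hxw, hyx⟩,
      ⟨z, hzA, hz⟩⟩ := linkage (G := G) (D := D) (Y := {x | ∃ y, y ∉ D ∧ y ≠ v ∧ y ≠ w ∧ G.Adj x y})
      (Z := {x | G.Adj v x ∨ G.Adj x w}) c.hm hD h1 h2 ⟨d0, hd0, x0, hx0, hx0v, hx0w, hdx0⟩
      ⟨a, ha, Or.inl hva⟩ (by
    intro U t hU ht hm1 hm2 hcl
    obtain ⟨u0, hu0⟩ : ∃ u, u ∈ U := by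
      rcases hm1 with h | h
      · exact ⟨_, h⟩
      · rcases hm2 with h' | h'
        · exact ⟨_, h'⟩
        · exact absurd (h.trans h'.symm) c.hm
    obtain ⟨y, hyU, hyt⟩ : ∃ y, y ∉ U ∧ y ≠ t := by
      by_cases h : v = t
      · exact ⟨w, fun h => g.wD (hU h), fun h' => c.hvw.ne (h.trans h'.symm)⟩
      · exact ⟨v, fun h => g.vD (hU h), h⟩
    obtain ⟨u, hu, x, hxU, hxt, -, hux⟩ := c.K U t t y u0 hu0 ht ht hyU hyt hyt
    have huxG : G.Adj u x := c.toG hux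
      (fun h => by rcases hm2 with h' | h'
                   · exact hxU (h.2 ▸ h')
                   · exact hxt (h.2.trans h'))
      (fun h => by rcases hm1 with h' | h'
                   · exact hxU (h.2 ▸ h')
                   · exact hxt (h.2.trans h'))
    have hxD : x ∉ D := fun hxD => (hcl u hu x hxD huxG).elim hxU hxt
    refine ⟨u, hu, ?_⟩
    by_cases hxv : x = v
    · subst hxv; exact Or.inr (Or.inl huxG.symm)
    by_cases hxw : x = w
    · subst hxw; exact Or.inr (Or.inr huxG)
    exact Or.inl ⟨x, hxD, hxv, hxw, huxG⟩)
  have hP1 : J G (insert x A1) i x :=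
    Cn_insert hc1 hyA hyx _ (Set.mem_insert_of_mem _ hi) _ (Set.mem_insert _ _)
  have hd1 : ∀ z ∈ insert x A1, z ∉ A2 := by
    rintro z (rfl | hz) hz2
    · exact hx (hA2 hz2)
    · exact Set.disjoint_left.1 hdis hz hz2
  have hv1 : v ∉ insert x A1 := by
    rintro (h | h)
    · exact hxv h.symm
    · exact g.vD (hA1 h)
  have hw1 : w ∉ insert x A1 := by
    rintro (h | h)
    · exact hxw h.symm
    · exact g.wD (hA1 h)
  rcases hz with hz | hz
  · exact fin c g hij (r := v) (hD z (hA2 hzA) b hb) hz hwb.symm g.vD g.wD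
      (fun z hz hz' => absurd hz hz') (Or.inl rfl) hP1 hx (hc2 j hj z hzA) hd1 hv1 hw1
      (fun h => g.vD (hA2 h)) (fun h => g.wD (hA2 h))
  · exact fin c g hij (r := v) (hD a ha z (hA2 hzA)) hva hz g.vD g.wD
      (fun z hz hz' => absurd hz hz') (Or.inr rfl) hP1 hx (hc2 j hj z hzA) hd1 hv1 hw1
      (fun h => g.vD (hA2 h)) (fun h => g.wD (hA2 h))

theorem sub1' [DecidableEq V] {G G0 Γ : SimpleGraph V} {m1 m2 v w : V}
    (c : Ctx G G0 Γ m1 m2 v w) {D : Set V} (g : Good G G0 Γ m1 m2 v w D) (h1 : m1 ∈ D)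
    (h2 : m2 ∈ D) (hJ : ¬ J G D m1 m2) (hv : ∃ a ∈ comp G D m1, G.Adj v a)
    (hw : ∃ a ∈ comp G D m1, G.Adj w a)
    (hX : ∃ d ∈ comp G D m2, ∃ x, x ∉ D ∧ x ≠ v ∧ x ≠ w ∧ G.Adj d x) : Concl G m1 m2 v w := by
  obtain ⟨a, ha, hva⟩ := hv
  obtain ⟨b, hb, hwb⟩ := hw
  obtain ⟨d, hd, x, hx, hxv, hxw, hdx⟩ := hX
  refine fin c g (Or.inr ⟨rfl, rfl⟩) (S := comp G D m1) (r := v) (S1 := insert x (comp G D m2))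
    (S2 := comp G D m1) (comp_Cn a ha b hb) hva hwb.symm (fun h => g.vD (comp_sub h))
    (fun h => g.wD (comp_sub h)) (fun z hz hz' => absurd (comp_sub hz) hz') (Or.inl rfl)
    (Cn_insert comp_Cn hd hdx _ (Set.mem_insert_of_mem _ (comp_self h2)) _ (Set.mem_insert _ _))
    hx (comp_J ha) ?_ ?_ ?_ (fun h => g.vD (comp_sub h)) (fun h => g.wD (comp_sub h))
  · rintro z (rfl | hz) hz'
    · exact hx (comp_sub hz')
    · exact hJ (J.trans hz' (J.symm hz))
  · rintro (h | h)
    · exact hxv h.symm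
    · exact g.vD (comp_sub h)
  · rintro (h | h)
    · exact hxw h.symm
    · exact g.wD (comp_sub h)

theorem sub1 [DecidableEq V] {G G0 Γ : SimpleGraph V} {m1 m2 v w : V}
    (c : Ctx G G0 Γ m1 m2 v w) {D : Set V} (g : Good G G0 Γ m1 m2 v w D) (h1 : m1 ∈ D)
    (h2 : m2 ∈ D) (hJ : ¬ J G D m1 m2) (hv : ∃ a ∈ comp G D m1, G.Adj v a)
    (hw : ∃ a ∈ comp G D m1, G.Adj w a) : Concl G m1 m2 v w := by
  by_cases hX : ∃ d ∈ comp G D m2, ∃ x, x ∉ D ∧ x ≠ v ∧ x ≠ w ∧ G.Adj d x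
  · exact sub1' c g h1 h2 hJ hv hw hX
  have hm1 : m1 ∉ comp G D m2 := fun h => hJ (J.symm h)
  have key : ∀ s y, s ∉ D → y ∉ D → y ≠ s →
      ∃ u ∈ comp G D m2, ∃ x, x ∉ D ∧ x ≠ s ∧ G.Adj u x := by
    intro s y hs hy hys
    obtain ⟨u, hu, x, hx, hxs, hxm, hux⟩ := c.K (comp G D m2) s m1 y m2 (comp_self h2)
      (fun h => hs (comp_sub h)) hm1 (fun h => hy (comp_sub h)) hys (fun h => hy (h ▸ h1))
    have huxG := c.toG hux (fun h => hm1 (h.1 ▸ hu)) (fun h => hxm h.2)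
    exact ⟨u, hu, x, fun hxD => hx (comp_step hu hxD huxG), hxs, huxG⟩
  obtain ⟨u, hu, x, hxD, hxv, hux⟩ := key v w g.vD g.wD c.hvw.ne.symm
  obtain ⟨u', hu', x', hxD', hxw', hux'⟩ := key w v g.wD g.vD c.hvw.ne
  have hxw : x = w := by
    by_contra h
    exact hX ⟨u, hu, x, hxD, hxv, h, hux⟩
  have hxv' : x' = v := by
    by_contra h
    exact hX ⟨u', hu', x', hxD', h, hxw', hux'⟩
  subst hxw hxv'
  obtain ⟨x0, hx0, hx0v, hx0w⟩ := g.X c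
  obtain ⟨d0, hd0, hdx0⟩ := g.xnb c h1 h2 hx0 hx0v hx0w
  refine (sub1' c.swapm g.swapm h2 h1 (fun h => hJ h.symm) ⟨u', hu', hux'.symm⟩
    ⟨u, hu, hux.symm⟩ ⟨d0, ?_, x0, hx0, hx0v, hx0w, hdx0⟩).swapm
  refine (g.split c h1 h2 hd0).resolve_right fun h => hX ⟨d0, h, x0, hx0, hx0v, hx0w, hdx0⟩

/-- All cases with a component touching both ends. -/
theorem easy [Finite V] [DecidableEq V] {G G0 Γ : SimpleGraph V} {m1 m2 v w : V}
    (c : Ctx G G0 Γ m1 m2 v w) {D : Set V} (g : Good G G0 Γ m1 m2 v w D) (h2 : m2 ∈ D)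
    (hv : ∃ a ∈ comp G D m2, G.Adj v a)
    (hw : ∃ a ∈ comp G D m2, G.Adj w a) : Concl G m1 m2 v w := by
  by_cases h1 : m1 ∈ D
  · by_cases hJ : J G D m1 m2
    · exact case2a c g h1 hJ
    · exact (sub1 c.swapm g.swapm h2 h1 (fun h => hJ h.symm) hv hw).swapm
  · exact case1 c g h1

theorem sub2 [Finite V] [DecidableEq V] {G G0 Γ : SimpleGraph V} {m1 m2 v w : V}
    (c : Ctx G G0 Γ m1 m2 v w) {D : Set V} (g : Good G G0 Γ m1 m2 v w D) (h1 : m1 ∈ D)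
    (h2 : m2 ∈ D) (hJ : ¬ J G D m1 m2) (hv1 : ∃ a ∈ comp G D m1, G.Adj v a)
    (hw2 : ∃ a ∈ comp G D m2, G.Adj w a) (hv2 : ¬ ∃ a ∈ comp G D m2, G.Adj v a)
    (hw1 : ¬ ∃ a ∈ comp G D m1, G.Adj w a) : Concl G m1 m2 v w := by
  obtain ⟨a, ha, hva⟩ := hv1
  obtain ⟨b, hb, hwb⟩ := hw2
  have hd12 : ∀ z, z ∈ comp G D m1 → z ∉ comp G D m2 := fun z h h' => hJ (J.trans h (J.symm h'))
  by_cases hxx : ∃ x, x ∉ D ∧ x ≠ v ∧ x ≠ w ∧ (∃ d ∈ comp G D m1, G.Adj d x) ∧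
      (∃ d ∈ comp G D m2, G.Adj d x)
  · obtain ⟨x, hx, hxv, hxw, ⟨d1, hd1, hdx1⟩, ⟨d2, hd2, hdx2⟩⟩ := hxx
    have i1 : v ∉ insert x (comp G D m1) := by
      rintro (h | h)
      · exact hxv h.symm
      · exact g.vD (comp_sub h)
    have i2 : w ∉ insert x (comp G D m1) := by
      rintro (h | h)
      · exact hxw h.symm
      · exact g.wD (comp_sub h)
    have c1 : Cn G (insert x (comp G D m1)) := Cn_insert comp_Cn hd1 hdx1
    have c2 : Cn G (insert x (comp G D m2)) := Cn_insert comp_Cn hd2 hdx2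
    refine fin c g (Or.inl ⟨rfl, rfl⟩) (S := insert x (comp G D m1) ∪ insert x (comp G D m2))
      (r := x) (S1 := insert x (comp G D m1)) (S2 := comp G D m2) (a := a) (b := b) (x := x)
      (d := b)
      (((c1 a (Or.inr ha) x (Or.inl rfl)).mono Set.subset_union_left).trans
        ((c2 x (Or.inl rfl) b (Or.inr hb)).mono Set.subset_union_right)) hva hwb.symm ?_ ?_ ?_
      (Or.inr rfl) (c1 _ (Or.inr (comp_self h1)) _ (Or.inl rfl)) hx (comp_J hb) ?_ i1 i2
      (fun h => g.vD (comp_sub h)) (fun h => g.wD (comp_sub h))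
    · rintro (h | h | h)
      · exact i1 h
      · exact hxv h.symm
      · exact g.vD (comp_sub h)
    · rintro (h | h | h)
      · exact i2 h
      · exact hxw h.symm
      · exact g.wD (comp_sub h)
    · rintro z ((h | h) | (h | h)) hz
      · exact h
      · exact absurd (comp_sub h) hz
      · exact h
      · exact absurd (comp_sub h) hz
    · rintro z (rfl | h) hz
      · exact hx (comp_sub hz)
      · exact hd12 z h hz
  obtain ⟨Q, hQ, hQD⟩ := g.join.path
  have hQs : ∀ z, z ∉ D → z ∈ Q.support := by
    intro z hz
    by_cases hzv : z = v
    · subst hzv; exact Q.start_mem_support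
    by_cases hzw : z = w
    · subst hzw; exact Q.end_mem_support
    by_contra hzQ
    exact g.sep z hz hzv hzw ⟨Q, fun y hy => ⟨hQD y hy, fun h => hzQ (h ▸ hy)⟩⟩
  have hq : ∀ k, Q.getVert k ∉ D := fun k => hQD _ (Q.getVert_mem_support k)
  have hidx : ∀ z, z ∉ D → ∃ k, k ≤ Q.length ∧ z = Q.getVert k := by
    intro z hz
    obtain ⟨k, hk, hk'⟩ := Walk.mem_support_iff_exists_getVert.1 (hQs z hz)
    exact ⟨k, hk', hk.symm⟩
  have hqv : ∀ k, 0 < k → k ≤ Q.length → Q.getVert k ≠ v := by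
    intro k hk hk' h
    have := gv_inj hQ hk' (Nat.zero_le _) (h.trans Q.getVert_zero.symm)
    omega
  have hqw : ∀ k, k < Q.length → Q.getVert k ≠ w := by
    intro k hk' h
    have := gv_inj hQ hk'.le le_rfl (h.trans Q.getVert_length.symm)
    omega
  have chord : ∀ i j, i + 1 < j → j ≤ Q.length → G.Adj (Q.getVert i) (Q.getVert j) →
      i = 0 ∧ j = Q.length := by
    intro i j hij hj hadj
    by_contra hne
    have hG0 : G0.Adj (Q.getVert i) (Q.getVert j) := by
      rw [c.h0]
      refine ⟨hadj, fun h => ?_⟩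
      rcases Sym2.eq_iff.1 h with ⟨h, h'⟩ | ⟨h, h'⟩
      · have e1 := gv_inj hQ (by omega) (Nat.zero_le _) (h.trans Q.getVert_zero.symm)
        have e2 := gv_inj hQ hj le_rfl (h'.trans Q.getVert_length.symm)
        exact hne ⟨e1, e2⟩
      · exact hqw i (by omega) h
    refine g.sep (Q.getVert (i + 1)) (hq _) (hqv _ (by omega) (by omega)) (hqw _ (by omega))
      (bypass0 hQ (E := Dᶜ) (fun x hx => hQD x hx) (i := i) (j := i + 1) (k := j) (by omega) hij hj
        (J.adj ⟨hq _, fun h => ?_⟩ ⟨hq _, fun h => ?_⟩ hG0))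
    · have := gv_inj hQ (by omega) (by omega) h
      omega
    · have := gv_inj hQ (by omega) (by omega) h
      omega
  have hlen : 1 < Q.length := by
    by_contra hl
    obtain ⟨x, hx, hxv, hxw⟩ := g.X c
    obtain ⟨k, hk, rfl⟩ := hidx x hx
    rcases Nat.lt_or_ge 0 k with h | h
    · have : k = Q.length := by omega
      rw [this] at hxw
      exact hxw Q.getVert_length
    · have : k = 0 := by omega
      rw [this] at hxv
      exact hxv Q.getVert_zero
  by_cases hlr : ∃ i j, 0 < i ∧ i < j ∧ j < Q.length ∧
      (∃ d ∈ comp G D m2, G.Adj d (Q.getVert i)) ∧ (∃ d ∈ comp G D m1, G.Adj d (Q.getVert j))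
  · obtain ⟨i, j, hi, hij, hj, ⟨d2, hd2, hdi⟩, ⟨d1, hd1, hdj⟩⟩ := hlr
    set T : Set V := {x | ∃ k, 1 ≤ k ∧ k ≤ i ∧ x = Q.getVert k} with hT
    have hTQ : ∀ x ∈ T, J G (T ∪ comp G D m2) x (Q.getVert i) := by
      rintro x ⟨k, hk, hki, rfl⟩
      refine (seg Q k i hki (by omega)).mono' ?_ (fun _ _ _ _ h => c.g0_le h)
      rintro x ⟨l, hl, hl', rfl⟩
      exact Or.inl ⟨l, by omega, hl', rfl⟩
    have hTi : Q.getVert i ∈ T := ⟨i, hi, le_rfl, rfl⟩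
    have hE : Cn G (T ∪ comp G D m2) := by
      apply Cn_of (a := Q.getVert i)
      rintro x (hx | hx)
      · exact (hTQ x hx).symm
      · exact (J.adj (S := T ∪ comp G D m2) (Or.inl hTi) (Or.inr hd2) hdi.symm).trans
          ((comp_Cn d2 hd2 x hx).mono Set.subset_union_right)
    have hvE : v ∉ T ∪ comp G D m2 := by
      rintro (⟨k, hk, hki, h⟩ | h)
      · exact hqv k hk (by omega) h.symm
      · exact g.vD (comp_sub h)
    have hwE : w ∉ T ∪ comp G D m2 := by
      rintro (⟨k, hk, hki, h⟩ | h)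
      · exact hqw k (by omega) h.symm
      · exact g.wD (comp_sub h)
    have hD1E : comp G D m1 ⊆ (T ∪ comp G D m2)ᶜ := by
      rintro z hz (⟨k, hk, hki, rfl⟩ | h)
      · exact hq k (comp_sub hz)
      · exact hd12 z hz h
    have hJE : J G0 (T ∪ comp G D m2)ᶜ v w := by
      have s1 : J G0 (T ∪ comp G D m2)ᶜ d1 a :=
        (comp_Cn d1 hd1 a ha).mono' hD1E (fun x hx y hy h => c.g0 h
          (fun h => g.vD (comp_sub (h ▸ hx))) (fun h => g.wD (comp_sub (h ▸ hx))))
      have s2 : G0.Adj a v := c.g0 hva.symm (fun h => g.vD (comp_sub (h ▸ ha)))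
        (fun h => g.wD (comp_sub (h ▸ ha)))
      have s3 : G0.Adj d1 (Q.getVert j) := c.g0 hdj (fun h => g.vD (comp_sub (h ▸ hd1)))
        (fun h => g.wD (comp_sub (h ▸ hd1)))
      have s4 := (seg Q j Q.length hj.le le_rfl).mono (T := (T ∪ comp G D m2)ᶜ) (by
        rintro x ⟨k, hk, hk', rfl⟩ (⟨l, hl, hl', h⟩ | h)
        · have := gv_inj hQ (by omega) (by omega) h
          omega
        · exact hq k (comp_sub h))
      rw [Q.getVert_length] at s4
      exact ((s1.step hvE s2).symm.trans (J.adj s1.left s4.left s3)).trans s4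
    obtain ⟨D', hD', g'⟩ := exists_good c (D0 := T ∪ comp G D m2) (Or.inr (Or.inr (comp_self h2)))
      hvE hwE (fun x hx y hy => (hE x hx y hy).mono' le_rfl (fun _ _ _ _ h => c.ofG h)) hJE
    have hcomp : T ∪ comp G D m2 ⊆ comp G D' m2 := fun x hx =>
      (hE m2 (Or.inr (comp_self h2)) x hx).mono hD'
    refine easy c g' (hD' (Or.inr (comp_self h2))) ⟨Q.getVert 1, hcomp (Or.inl ⟨1, le_rfl, hi, rfl⟩),
      ?_⟩ ⟨b, hcomp (Or.inr hb), hwb⟩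
    have := Q.adj_getVert_succ (i := 0) (by omega)
    rw [Q.getVert_zero] at this
    exact c.g0_le this
  · exfalso
    -- some vertex of the cycle is adjacent to the first component
    have hm2 : m2 ∉ comp G D m1 := fun h => hJ h
    obtain ⟨k0, hk0, hk0', hk0d⟩ : ∃ k, 0 < k ∧ k < Q.length ∧
        ∃ d ∈ comp G D m1, G.Adj d (Q.getVert k) := by
      obtain ⟨u, hu, x, hx, hxv, hxm, hux⟩ := c.K (comp G D m1) v m2 w m1 (comp_self h1)
        (fun h => g.vD (comp_sub h)) hm2 (fun h => g.wD (comp_sub h)) c.hvw.ne.symm c.w2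
      have huxG := c.toG hux (fun h => hxm h.2) (fun h => hm2 (h.1 ▸ hu))
      have hxD : x ∉ D := fun hxD => hx (comp_step hu hxD huxG)
      have hxw : x ≠ w := fun h => hw1 ⟨u, hu, h ▸ huxG.symm⟩
      obtain ⟨k, hk, rfl⟩ := hidx x hxD
      refine ⟨k, ?_, ?_, u, hu, huxG⟩
      · rcases Nat.eq_zero_or_pos k with rfl | h
        · exact absurd Q.getVert_zero hxv
        · exact h
      · rcases Nat.lt_or_ge k Q.length with h | h
        · exact h
        · have : k = Q.length := by omega
          subst this
          exact absurd Q.getVert_length hxw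
    classical
    obtain ⟨k, ⟨hk, hk', hkd⟩, hkmax⟩ : ∃ k, (0 < k ∧ k < Q.length ∧
        ∃ d ∈ comp G D m1, G.Adj d (Q.getVert k)) ∧ ∀ l, (0 < l ∧ l < Q.length ∧
        ∃ d ∈ comp G D m1, G.Adj d (Q.getVert l)) → l ≤ k := by
      let P : ℕ → Prop := fun k => 0 < k ∧ k < Q.length ∧
        ∃ d ∈ comp G D m1, G.Adj d (Q.getVert k)
      have hP : P k0 := ⟨hk0, hk0', hk0d⟩
      refine ⟨Nat.findGreatest P Q.length, Nat.findGreatest_spec (P := P) hk0'.le hP, ?_⟩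
      intro l hl
      exact Nat.le_findGreatest hl.2.1.le hl
    obtain ⟨x, hx, y, hy, hxy, hne, hab⟩ := c.cut
      ({x | ∃ l, l ≤ k ∧ x = Q.getVert l} ∪ comp G D m1) (Q.getVert k) (Q.getVert (k + 1))
      (Or.inl ⟨0, Nat.zero_le _, Q.getVert_zero.symm⟩)
      (by
        rintro (⟨l, hl, h⟩ | h)
        · exact hqw l (by omega) h.symm
        · exact g.wD (comp_sub h))
      (Or.inl ⟨k, le_rfl, rfl⟩)
      (by
        rintro (⟨l, hl, h⟩ | h)
        · have := gv_inj hQ (by omega) (by omega) h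
          omega
        · exact hq _ (comp_sub h))
    have hy1 : ∀ l, l ≤ k → y ≠ Q.getVert l := fun l hl h => hy (Or.inl ⟨l, hl, h⟩)
    have hy2 : y ∉ comp G D m1 := fun h => hy (Or.inr h)
    rcases hx with ⟨l, hl, rfl⟩ | hx
    · by_cases hyD : y ∈ D
      · have hyc := (g.split c h1 h2 hyD).resolve_left hy2
        rcases Nat.eq_zero_or_pos l with rfl | hl0
        · rw [Q.getVert_zero] at hxy
          exact hv2 ⟨y, hyc, hxy⟩
        · rcases Nat.lt_or_ge l k with hlk | hlk
          · exact hlr ⟨l, k, hl0, hlk, hk', ⟨y, hyc, hxy.symm⟩, hkd⟩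
          · have : l = k := by omega
            subst this
            exact hxx ⟨_, hq l, hqv l hk (by omega), hqw l hk', hkd, y, hyc, hxy.symm⟩
      · obtain ⟨r, hr, rfl⟩ := hidx y hyD
        have hrk : k < r := by
          by_contra h
          exact hy1 r (by omega) rfl
        rcases Nat.lt_or_ge (l + 1) r with h | h
        · obtain ⟨rfl, rfl⟩ := chord l r h hr hxy
          rw [Q.getVert_zero, Q.getVert_length] at hne
          exact hne rfl
        · have e1 : l = k := by omega
          have e2 : r = k + 1 := by omega
          subst e1 e2
          exact hab ⟨rfl, rfl⟩
    · have hyD : y ∉ D := fun h => hy2 (comp_step hx h hxy)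
      obtain ⟨r, hr, rfl⟩ := hidx y hyD
      have hrk : k < r := by
        by_contra h
        exact hy1 r (by omega) rfl
      rcases Nat.lt_or_ge r Q.length with h | h
      · have := hkmax r ⟨by omega, h, x, hx, hxy⟩
        omega
      · have : r = Q.length := by omega
        subst this
        rw [Q.getVert_length] at hxy
        exact hw1 ⟨x, hx, hxy.symm⟩

theorem initial {G G0 Γ : SimpleGraph V} {m1 m2 v w : V}
    (c : Ctx G G0 Γ m1 m2 v w) : J G0 {m2}ᶜ v w := by
  by_contra hJ
  have hv : v ∈ comp G0 {m2}ᶜ v := comp_self c.v2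
  have hstep : ∀ u x, u ∈ comp G0 {m2}ᶜ v → x ≠ m2 → Γ.Adj u x → u ≠ v →
      x ∈ comp G0 {m2}ᶜ v := by
    intro u x hu hx hux huv
    have hum : u ≠ m2 := comp_sub hu
    refine comp_step hu hx (c.g0 (c.toG hux (fun h => hx h.2) (fun h => hum h.1)) huv ?_)
    rintro rfl
    exact hJ hu
  by_cases hne : ∃ u, u ∈ comp G0 {m2}ᶜ v ∧ u ≠ v
  · obtain ⟨u0, hu0, hu0v⟩ := hne
    obtain ⟨u, hu, x, hx, hxv, hxm, hux⟩ := c.K (comp G0 {m2}ᶜ v \ {v}) v m2 w u0 ⟨hu0, hu0v⟩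
      (fun h => h.2 rfl) (fun h => comp_sub h.1 rfl) (fun h => hJ h.1) c.hvw.ne.symm c.w2
    exact hx ⟨hstep u x hu.1 hxm hux hu.2, hxv⟩
  · obtain ⟨y, hyv, hyw, hym⟩ := c.four v w m2
    obtain ⟨u, rfl, x, hx, hxw, hxm, hux⟩ := c.K {v} w m2 y v rfl c.hvw.ne.symm c.v2.symm
      hyv hyw hym
    have hG := c.toG hux (fun h => hxm h.2) (fun h => c.v2 h.1)
    refine hne ⟨x, comp_step hv hxm ?_, hx⟩
    rw [c.h0]
    refine ⟨hG, fun h => ?_⟩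
    rcases Sym2.eq_iff.1 h with ⟨_, h⟩ | ⟨h, _⟩
    · exact hxw h
    · exact c.hvw.ne h

theorem main_concl [Finite V] [DecidableEq V] {G G0 Γ : SimpleGraph V} {m1 m2 v w : V}
    (c : Ctx G G0 Γ m1 m2 v w) : Concl G m1 m2 v w := by
  obtain ⟨D, hD, g⟩ := exists_good c (D0 := {m2}) (Or.inr rfl) c.v2 c.w2 (Cn_single _) (initial c)
  have h2 : m2 ∈ D := hD rfl
  by_cases h1 : m1 ∈ D
  swap
  · exact case1 c g h1
  by_cases hJ : J G D m1 m2
  · exact case2a c g h1 hJ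
  have hJ' : ¬ J G D m2 m1 := fun h => hJ h.symm
  obtain ⟨a, ha, hva⟩ := g.vn
  obtain ⟨b, hb, hwb⟩ := g.wn
  by_cases hv1 : ∃ a ∈ comp G D m1, G.Adj v a
  · by_cases hw1 : ∃ a ∈ comp G D m1, G.Adj w a
    · exact sub1 c g h1 h2 hJ hv1 hw1
    · have hw2 : ∃ a ∈ comp G D m2, G.Adj w a :=
        ⟨b, (g.split c h1 h2 hb).resolve_left fun h => hw1 ⟨b, h, hwb⟩, hwb⟩
      by_cases hv2 : ∃ a ∈ comp G D m2, G.Adj v a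
      · exact (sub1 c.swapm g.swapm h2 h1 hJ' hv2 hw2).swapm
      · exact sub2 c g h1 h2 hJ hv1 hw2 hv2 hw1
  · have hv2 : ∃ a ∈ comp G D m2, G.Adj v a :=
      ⟨a, (g.split c h1 h2 ha).resolve_left fun h => hv1 ⟨a, h, hva⟩, hva⟩
    by_cases hw2 : ∃ a ∈ comp G D m2, G.Adj w a
    · exact (sub1 c.swapm g.swapm h2 h1 hJ' hv2 hw2).swapm
    · have hw1 : ∃ a ∈ comp G D m1, G.Adj w a :=
        ⟨b, (g.split c h1 h2 hb).resolve_right fun h => hw2 ⟨b, h, hwb⟩, hwb⟩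
      exact (sub2 c.swapm g.swapm h2 h1 hJ' hv2 hw1 hv1 hw2).swapm

theorem mkCtx [Fintype V] [DecidableEq V] (G : SimpleGraph V) (m1 m2 : V) (hm : m1 ≠ m2)
    (cond1 : ∀ e ∈ G.edgeSet, (∀ x ∈ e, x ≠ m1 ∧ x ≠ m2) →
      KEdgeConnected (G.deleteEdges {e}) 2)
    (cond2 : KVertexConnected (G ⊔ SimpleGraph.fromEdgeSet {s(m1, m2)}) 3)
    (v w : V) (hvw : G.Adj v w) (hn : v ≠ m1 ∧ v ≠ m2 ∧ w ≠ m1 ∧ w ≠ m2) :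
    Ctx G (G.deleteEdges {s(v, w)}) (G ⊔ SimpleGraph.fromEdgeSet {s(m1, m2)}) m1 m2 v w :=
  { hm := hm
    hΓ := by
      intro a b
      simp only [sup_adj, fromEdgeSet_adj, Set.mem_singleton_iff, Sym2.eq_iff]
      constructor
      · tauto
      · rintro (h | ⟨rfl, rfl⟩ | ⟨rfl, rfl⟩)
        · exact Or.inl h
        · exact Or.inr ⟨Or.inl ⟨rfl, rfl⟩, hm⟩
        · exact Or.inr ⟨Or.inr ⟨rfl, rfl⟩, hm.symm⟩
    h0 := by
      intro a b
      simp [deleteEdges_adj]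
    hvw := hvw
    v1 := hn.1
    v2 := hn.2.1
    w1 := hn.2.2.1
    w2 := hn.2.2.2
    four := by
      intro a b c
      by_contra hcon
      push Not at hcon
      have : (Finset.univ : Finset V) ⊆ {a, b, c} := by
        intro d _
        simp only [Finset.mem_insert, Finset.mem_singleton]
        have := hcon d
        tauto
      have h1 := Finset.card_le_card this
      have h2 : ({a, b, c} : Finset V).card ≤ 3 := Finset.card_le_three
      have := cond2.1
      rw [Finset.card_univ] at h1
      omega
    K := by
      intro U s t y u0 hu0 hs ht hy hys hyt
      by_contra hcon
      push Not at hcon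
      have hc := cond2.2 {s, t} (lt_of_le_of_lt Finset.card_le_two (by norm_num))
      have hmem : ∀ x, x ≠ s → x ≠ t → x ∈ (↑(({s, t} : Finset V)ᶜ) : Set V) := by
        intro x h1 h2
        simp [h1, h2]
      obtain ⟨p⟩ := hc.preconnected ⟨u0, hmem u0 (fun h => hs (h ▸ hu0)) (fun h => ht (h ▸ hu0))⟩
        ⟨y, hmem y hys hyt⟩
      have key : ∀ (a b : (↑(({s, t} : Finset V)ᶜ) : Set V))
          (_ : ((G ⊔ SimpleGraph.fromEdgeSet {s(m1, m2)}).induce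
            (↑(({s, t} : Finset V)ᶜ) : Set V)).Walk a b), (a : V) ∈ U → (b : V) ∈ U := by
        intro a b q
        induction q with
        | nil => exact id
        | @cons a b' c' hadj q ih =>
          intro ha
          apply ih
          by_contra hb
          have hb' := b'.2
          simp only [Finset.coe_compl, Set.mem_compl_iff, Finset.coe_insert, Finset.coe_singleton,
            Set.mem_insert_iff, Set.mem_singleton_iff, not_or] at hb'
          exact hcon a ha b' hb hb'.1 hb'.2 hadj
      exact hy (key _ _ p hu0)
    cut := by
      intro U a b hv hw ha hb
      by_contra hcon
      push Not at hcon
      have hc := (cond1 s(v, w) hvw (by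
        intro x hx
        rcases Sym2.mem_iff.1 hx with rfl | rfl
        · exact ⟨hn.1, hn.2.1⟩
        · exact ⟨hn.2.2.1, hn.2.2.2⟩)).2 {s(a, b)} (by simp)
      obtain ⟨p⟩ := hc.preconnected v w
      have := J.closed (S := Set.univ) ⟨p, fun _ _ => trivial⟩ U hv (by
        intro x hx y _ hxy
        by_contra hy
        simp only [deleteEdges_adj, Finset.coe_singleton, Set.mem_singleton_iff] at hxy
        obtain ⟨h1, h2⟩ := hcon x hx y hy hxy.1.1 hxy.1.2
        exact hxy.2 (by rw [h1, h2]))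
      exact hw this }


end CPIL

/-- Under Conditions ① and ②, every interior link vw admits a
non-separating cycle F through vw, a cycle C through vw sharing at most 3 vertices
with F, and disjoint simple paths P1, P2 from the two monitors to F − v − w and
C − v − w respectively, each avoiding v, w and meeting its cycle in exactly one vertex. -/
theorem cycles_and_paths_for_interior_link {V : Type*} [Fintype V] [DecidableEq V]
    (G : SimpleGraph V) (hG : G.Connected)
    (m1 m2 : V) (hm : m1 ≠ m2) (hnadj : ¬ G.Adj m1 m2)
    (hH : (G.induce {v | v ≠ m1 ∧ v ≠ m2}).Connected)
    (cond1 : ∀ e ∈ G.edgeSet, (∀ x ∈ e, x ≠ m1 ∧ x ≠ m2) →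
      KEdgeConnected (G.deleteEdges {e}) 2)
    (cond2 : KVertexConnected (G ⊔ SimpleGraph.fromEdgeSet {s(m1, m2)}) 3) :
    ∀ v w : V, G.Adj v w → (v ≠ m1 ∧ v ≠ m2 ∧ w ≠ m1 ∧ w ≠ m2) →
    ∃ (a b : V) (F : G.Walk a a) (C : G.Walk b b),
      F.IsCycle ∧ C.IsCycle ∧ s(v, w) ∈ F.edges ∧ s(v, w) ∈ C.edges ∧
      NonSeparatingCycle G m1 m2 F ∧
      (F.support.toFinset ∩ C.support.toFinset).card ≤ 3 ∧
      ∃ p : V × V, (p = (m1, m2) ∨ p = (m2, m1)) ∧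
      ∃ (x y : V) (P1 : G.Walk p.1 x) (P2 : G.Walk p.2 y),
        P1.IsPath ∧ P2.IsPath ∧
        x ∈ F.support ∧ x ≠ v ∧ x ≠ w ∧
        y ∈ C.support ∧ y ≠ v ∧ y ≠ w ∧
        (∀ z, z ∈ P1.support → z ∉ P2.support) ∧
        v ∉ P1.support ∧ w ∉ P1.support ∧ v ∉ P2.support ∧ w ∉ P2.support ∧
        (P1.support.toFinset ∩ F.support.toFinset).card = 1 ∧
        (P2.support.toFinset ∩ C.support.toFinset).card = 1 := by
  intro v w hvw hn
  exact CPIL.main_concl (CPIL.mkCtx G m1 m2 hm cond1 cond2 v w hvw hn)
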